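/- For all real numbers v > 0, c > 0 and γ > 0, the supremum over λ ∈ (0, 1/c) of the function λ ↦ γλ − λ²v/(2(1 − cλ)) equals (v/c²)·h₁(cγ/v), where h₁(u) := 1 + u − √(1 + 2u). -/

import Mathlib

open Real

/-- Completing the square in the sub-gamma Cramér–Chernoff exponent. -/
theorem sub_gamma_exponent_eq {v c γ l s : ℝ} (hv : v ≠ 0) (hc : c ≠ 0) (hl : 1 - c * l ≠ 0)
    (hs : s ^ 2 = 1 + 2 * (c * γ / v)) :
    γ * l - l ^ 2 * v / (2 * (1 - c * l))
      = v / c ^ 2 * (1 + c * γ / v - s)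
        - v / (2 * c ^ 2) * ((s * (1 - c * l) - 1) ^ 2 / (1 - c * l)) := by
  have hγ : γ = (s ^ 2 - 1) * v / (2 * c) := by
    rw [hs]
    field_simp
    ring
  subst hγ
  field_simp
  ring

/-- **Fenchel–Legendre transform in the Cramér–Chernoff method.**
For `v, c, γ > 0`, the supremum over `λ ∈ (0, 1/c)` of `γλ - λ²v/(2(1 - cλ))`
equals `(v/c²) · h₁(cγ/v)` where `h₁ u = 1 + u - √(1 + 2u)`. -/
theorem cramer_chernoff_sup (v c γ : ℝ) (hv : 0 < v) (hc : 0 < c) (hγ : 0 < γ) :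
    sSup ((fun l => γ * l - l ^ 2 * v / (2 * (1 - c * l))) '' Set.Ioo 0 (1 / c))
      = v / c ^ 2 * (1 + c * γ / v - Real.sqrt (1 + 2 * (c * γ / v))) := by
  have hu : 0 < c * γ / v := by positivity
  have hs : √(1 + 2 * (c * γ / v)) ^ 2 = 1 + 2 * (c * γ / v) := Real.sq_sqrt (by positivity)
  have hs1 : 1 < √(1 + 2 * (c * γ / v)) := Real.lt_sqrt_of_sq_lt (by linarith)
  set s := √(1 + 2 * (c * γ / v))
  have hs0 : 0 < s := one_pos.trans hs1
  refine IsGreatest.csSup_eq ⟨⟨(1 - s⁻¹) / c, ⟨?_, ?_⟩, ?_⟩, ?_⟩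
  · exact div_pos (sub_pos.2 (inv_lt_one_of_one_lt₀ hs1)) hc
  · gcongr
    exact sub_lt_self _ (inv_pos.2 hs0)
  · have hw : 1 - c * ((1 - s⁻¹) / c) = s⁻¹ := by
      rw [mul_div_cancel₀ _ hc.ne']
      ring
    dsimp only
    rw [sub_gamma_exponent_eq hv.ne' hc.ne' (hw.trans_ne (inv_ne_zero hs0.ne')) hs, hw,
      mul_inv_cancel₀ hs0.ne']
    simp
  · rintro _ ⟨l, ⟨-, hl⟩, rfl⟩
    have hw : 0 < 1 - c * l := sub_pos.2 ((lt_div_iff₀' hc).1 hl)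
    dsimp only
    rw [sub_gamma_exponent_eq hv.ne' hc.ne' hw.ne' hs]
    exact sub_le_self _ (by positivity)
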